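/- Let c ∈ C_k(n,q) with weight less than 2q^k and suppose (c,S) ≠ 0 for some (n−k)-space S. Then the support of c is a minimal k-blocking set of PG(n,q), all nonzero coordinates of c equal a single value a ∈ F_p^*, and supp(c) meets every (n−k)-space in 1 mod p points. -/

import Mathlib

open scoped Classical

noncomputable section

/-- The point set of `PG(n,q)`, `q = p^h`: the projectivization of `F_q^{n+1}`. -/
abbrev PGPoint (p h n : ℕ) [Fact p.Prime] :=
  Projectivization (GaloisField p h) (Fin (n+1) → GaloisField p h)

noncomputable instance (p h n : ℕ) [Fact p.Prime] : Fintype (PGPoint p h n) :=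
  @Fintype.ofFinite _ (Quotient.finite _)

/-- Incidence vector (over `F_p`) of the point set of the projective subspace
determined by a submodule `W`. -/
def incVec (p h n : ℕ) [Fact p.Prime]
    (W : Submodule (GaloisField p h) (Fin (n+1) → GaloisField p h)) :
    PGPoint p h n → ZMod p :=
  fun P => if P.submodule ≤ W then 1 else 0

/-- The `p`-ary code `C_k(n,q)` generated by the incidence vectors of the
`k`-spaces (i.e. submodules of rank `k+1`) of `PG(n,q)`. -/
def PGCode (p h n k : ℕ) [Fact p.Prime] :
    Submodule (ZMod p) (PGPoint p h n → ZMod p) :=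
  Submodule.span (ZMod p)
    { c | ∃ W : Submodule (GaloisField p h) (Fin (n+1) → GaloisField p h),
        Module.finrank (GaloisField p h) W = k + 1 ∧ c = incVec p h n W }

/-- Standard inner product of two words over `F_p`. -/
def ip {X : Type*} [Fintype X] {p : ℕ} (c d : X → ZMod p) : ZMod p :=
  ∑ x, c x * d x

/-- The dual code of a code `C`. -/
def dualCode {X : Type*} [Fintype X] {p : ℕ}
    (C : Submodule (ZMod p) (X → ZMod p)) : Submodule (ZMod p) (X → ZMod p) where
  carrier := { v | ∀ c ∈ C, ip v c = 0 }
  zero_mem' := by intro c hc; simp [ip]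
  add_mem' := by
    intro a b ha hb c hc
    simp only [Set.mem_setOf_eq, ip, Pi.add_apply, add_mul, Finset.sum_add_distrib] at *
    rw [ha c hc, hb c hc, add_zero]
  smul_mem' := by
    intro r a ha c hc
    simp only [Set.mem_setOf_eq, ip, Pi.smul_apply, smul_eq_mul, mul_assoc, ← Finset.mul_sum] at *
    rw [ha c hc, mul_zero]

/-- Hamming weight of a word. -/
def wt {X : Type*} [Fintype X] {p : ℕ} (c : X → ZMod p) : ℕ :=
  (Finset.univ.filter fun x => c x ≠ 0).card

/-- A set of points of `PG(n,q)` is a `k`-blocking set if it meets every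
`(n-k)`-dimensional subspace. -/
def IsKBlockingSet (p h n k : ℕ) [Fact p.Prime] (B : Set (PGPoint p h n)) : Prop :=
  ∀ S : Submodule (GaloisField p h) (Fin (n+1) → GaloisField p h),
    Module.finrank (GaloisField p h) S = n - k + 1 → ∃ P ∈ B, P.submodule ≤ S

lemma exists_between_finrank {K V : Type*} [Field K] [AddCommGroup V] [Module K V]
    [FiniteDimensional K V] (L X : Submodule K V) (hLX : L ≤ X) (r : ℕ)
    (h1 : Module.finrank K L ≤ r) (h2 : r ≤ Module.finrank K X) :
    ∃ S : Submodule K V, L ≤ S ∧ S ≤ X ∧ Module.finrank K S = r := by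
  induction r, h1 using Nat.le_induction with
  | base => exact ⟨L, le_rfl, hLX, rfl⟩
  | succ m hm ih =>
    obtain ⟨S, hLS, hSX, hS⟩ := ih (by omega)
    have hlt : S < X := by
      refine lt_of_le_of_ne hSX ?_
      rintro rfl
      omega
    obtain ⟨v, hvX, hvS⟩ := SetLike.exists_of_lt hlt
    refine ⟨S ⊔ Submodule.span K {v}, hLS.trans le_sup_left,
      sup_le hSX (by simpa using hvX), ?_⟩
    have hlt2 : S < S ⊔ Submodule.span K {v} := by
      refine lt_of_le_of_ne le_sup_left ?_
      intro h
      apply hvS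
      rw [h]
      exact Submodule.mem_sup_right (Submodule.mem_span_singleton_self v)
    have h3 := Submodule.finrank_lt_finrank_of_lt hlt2
    have h4 := Submodule.finrank_add_le_finrank_add_finrank S (Submodule.span K {v})
    have h5 : Module.finrank K (Submodule.span K {v}) ≤ 1 := by
      simpa using finrank_span_le_card (R := K) ({v} : Set V)
    omega

/-- Jamison's bound in the affine plane. -/
lemma jamison_plane {K ι : Type*} [Field K] [Fintype K] (U : Finset ι) (x y : ι → K)
    (hU : ∀ a b c : K, (a ≠ 0 ∨ b ≠ 0) → ∃ u ∈ U, a * x u + b * y u + c = 0) :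
    2 * (Fintype.card K - 1) + 1 ≤ U.card := by
  obtain ⟨u0, hu0, -⟩ := hU 1 0 0 (Or.inl one_ne_zero)
  by_contra hlt
  set lin : ι → MvPolynomial (Fin 2) K := fun u =>
    MvPolynomial.C (x u - x u0) * MvPolynomial.X 0
      + MvPolynomial.C (y u - y u0) * MvPolynomial.X 1 - MvPolynomial.C 1 with hlin
  set G : MvPolynomial (Fin 2) K := ∏ u ∈ U.erase u0, lin u with hG
  have hdeg1 : ∀ u, (lin u).totalDegree ≤ 1 := by
    intro u
    refine (MvPolynomial.totalDegree_sub _ _).trans (max_le ?_ (by simp))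
    refine (MvPolynomial.totalDegree_add _ _).trans (max_le ?_ ?_) <;>
    · refine (MvPolynomial.totalDegree_mul _ _).trans ?_
      rw [MvPolynomial.totalDegree_C, MvPolynomial.totalDegree_X]
  have hdeg : G.totalDegree ≤ U.card - 1 := by
    refine (MvPolynomial.totalDegree_finsetProd _ _).trans ?_
    refine (Finset.sum_le_card_nsmul _ _ 1 (fun u _ => hdeg1 u)).trans ?_
    simp [Finset.card_erase_of_mem hu0]
  have hq : 1 < Fintype.card K := Fintype.one_lt_card
  have hsum := MvPolynomial.sum_eval_eq_zero G (by simp only [Fintype.card_fin]; omega)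
  have hev : ∀ z : Fin 2 → K, MvPolynomial.eval z G
      = ∏ u ∈ U.erase u0, ((x u - x u0) * z 0 + (y u - y u0) * z 1 - 1) := by
    intro z
    simp [hG, hlin]
  rw [Finset.sum_eq_single (0 : Fin 2 → K)] at hsum
  · rw [hev] at hsum
    simp at hsum
  · intro z _ hz
    have hz' : z 0 ≠ 0 ∨ z 1 ≠ 0 := by
      by_contra hcon
      push Not at hcon
      apply hz
      funext i
      fin_cases i
      · exact hcon.1
      · exact hcon.2
    obtain ⟨u, hu, hu'⟩ := hU (z 0) (z 1) (-(z 0 * x u0 + z 1 * y u0) - 1) hz'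
    rw [hev]
    refine Finset.prod_eq_zero (i := u) (Finset.mem_erase.2 ⟨?_, hu⟩) (by linear_combination hu')
    rintro rfl
    apply one_ne_zero (α := K)
    linear_combination -hu'
  · simp

lemma card_fiber_mul {K A : Type*} {k : ℕ} [Field K] [Fintype K] [AddCommGroup A] [Module K A]
    [Fintype A] (e : A →ₗ[K] (Fin k → K)) (he : Function.Surjective e) :
    Nat.card (LinearMap.ker e) * Fintype.card K ^ k = Fintype.card A := by
  have : Fintype (LinearMap.ker e) := Fintype.ofFinite _
  have : Module.Finite K A := Module.Finite.of_finite
  have h2 := LinearMap.finrank_range_add_finrank_ker e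
  rw [LinearMap.range_eq_top.2 he] at h2
  simp only [finrank_top, Module.finrank_fin_fun] at h2
  rw [Nat.card_eq_fintype_card, Module.card_eq_pow_finrank (K := K) (V := LinearMap.ker e),
    Module.card_eq_pow_finrank (K := K) (V := A), ← h2, pow_add, mul_comm]

/-- Averaging over the kernel of a linear map. -/
lemma exists_ker_few_zeros {K M ι : Type*} [Field K] [Fintype K] [AddCommGroup M] [Module K M]
    [FiniteDimensional K M] (k : ℕ) (ρ : M →ₗ[K] (Fin k → K)) (X : Finset ι)
    (ev : ι → M →ₗ[K] (Fin k → K))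
    (hv : ∀ i ∈ X, ∀ y, ∃ f, ρ f = 0 ∧ ev i f = y)
    (hX : X.card < 2 * Fintype.card K ^ k) :
    ∃ f : M, ρ f = 0 ∧ (X.filter fun i => ev i f = 0).card ≤ 1 := by
  by_contra hcon
  push Not at hcon
  let A : Submodule K M := LinearMap.ker ρ
  have : Finite A := Module.finite_of_finite K
  have : Fintype A := Fintype.ofFinite A
  have hsum : ∑ f : A, (X.filter fun i => ev i f.1 = 0).card
      = ∑ i ∈ X, (Finset.univ.filter fun f : A => ev i f.1 = 0).card := by
    simp only [Finset.card_filter]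
    exact Finset.sum_comm
  have hfib : ∀ i ∈ X, (Finset.univ.filter fun f : A => ev i f.1 = 0).card * Fintype.card K ^ k
      = Fintype.card A := by
    intro i hi
    let e : A →ₗ[K] (Fin k → K) := (ev i).comp A.subtype
    have hsurj : Function.Surjective e := by
      intro y
      obtain ⟨g, hg1, hg2⟩ := hv i hi y
      exact ⟨⟨g, hg1⟩, hg2⟩
    rw [← card_fiber_mul e hsurj]
    congr 1
    rw [← Fintype.card_subtype, ← Nat.card_eq_fintype_card]
    exact Nat.card_congr (Equiv.subtypeEquivRight (fun f => by simp [e]))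
  have hlow : 2 * Fintype.card A ≤ ∑ f : A, (X.filter fun i => ev i f.1 = 0).card := by
    have := Finset.card_nsmul_le_sum (Finset.univ : Finset A)
      (fun f => (X.filter fun i => ev i f.1 = 0).card) 2
      (fun f _ => hcon f.1 (LinearMap.mem_ker.1 f.2))
    simpa [mul_comm] using this
  have hA : 0 < Fintype.card A := Fintype.card_pos
  have hupp : (∑ f : A, (X.filter fun i => ev i f.1 = 0).card) * Fintype.card K ^ k
      = X.card * Fintype.card A := by
    rw [hsum, Finset.sum_mul, Finset.sum_congr rfl hfib]
    simp
  have h3 := Nat.mul_le_mul_right (Fintype.card K ^ k) hlow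
  rw [hupp] at h3
  have h4 : 2 * Fintype.card K ^ k ≤ X.card := by
    by_contra h
    push Not at h
    nlinarith
  omega

/-- Averaging over linear maps vanishing at `r`. -/
lemma exists_map_few_zeros {K V ι : Type*} [Field K] [Fintype K] [AddCommGroup V] [Module K V]
    [FiniteDimensional K V] (k : ℕ) (r : V) (X : Finset ι) (v : ι → V)
    (hv : ∀ i ∈ X, v i ∉ Submodule.span K {r})
    (hX : X.card < 2 * Fintype.card K ^ k) :
    ∃ f : V →ₗ[K] (Fin k → K), f r = 0 ∧ (X.filter fun i => f (v i) = 0).card ≤ 1 := by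
  refine exists_ker_few_zeros (M := V →ₗ[K] (Fin k → K)) k (LinearMap.applyₗ r) X
    (fun i => LinearMap.applyₗ (v i)) ?_ hX
  intro i hi y
  obtain ⟨g, hg1, hg2⟩ := LinearMap.exists_extend_of_notMem
    (0 : Submodule.span K {r} →ₗ[K] (Fin k → K)) (hv i hi) y
  refine ⟨g, ?_, hg2⟩
  have := congrArg (fun l => l ⟨r, Submodule.mem_span_singleton_self r⟩) hg1
  simpa using this

lemma exists_dual_zero_one {K V : Type*} [Field K] [AddCommGroup V] [Module K V]
    (S : Submodule K V) (v : V) (hv : v ∉ S) :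
    ∃ f : V →ₗ[K] K, (∀ s ∈ S, f s = 0) ∧ f v = 1 := by
  obtain ⟨f, h1, h2⟩ := LinearMap.exists_extend_of_notMem (0 : S →ₗ[K] K) hv 1
  refine ⟨f, fun s hs => ?_, h2⟩
  simpa using congrArg (fun l => l ⟨s, hs⟩) h1

lemma finrank_inf_ker {K V : Type*} [Field K] [AddCommGroup V] [Module K V]
    [FiniteDimensional K V] (T : Submodule K V) (f : V →ₗ[K] K) :
    Module.finrank K T ≤ Module.finrank K (T ⊓ LinearMap.ker f : Submodule K V) + 1 := by
  have h1 := Submodule.finrank_sup_add_finrank_inf_eq T (LinearMap.ker f)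
  have h2 := LinearMap.finrank_range_add_finrank_ker f
  have h3 := Submodule.finrank_le (T ⊔ LinearMap.ker f)
  have h4 := Submodule.finrank_le (LinearMap.range f)
  rw [Module.finrank_self] at h4
  omega

lemma rep_mem_span_iff {K V : Type*} [Field K] [AddCommGroup V] [Module K V]
    (P Q : Projectivization K V) : P.rep ∈ Submodule.span K {Q.rep} ↔ P = Q := by
  constructor
  · intro h
    obtain ⟨a, ha⟩ := Submodule.mem_span_singleton.1 h
    rw [← P.mk_rep, ← Q.mk_rep, Projectivization.mk_eq_mk_iff']
    exact ⟨a, ha⟩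
  · rintro rfl
    exact Submodule.mem_span_singleton_self _

/-- In each subspace just above `S`, at least `2q-1` points of `B` lie off `S`. -/
lemma two_pts_local {K V : Type*} [Field K] [Fintype K] [AddCommGroup V] [Module K V]
    [FiniteDimensional K V] (S : Submodule K V)
    (B : Finset (Projectivization K V)) (Q R : Projectivization K V) (hQR : Q ≠ R)
    (hQS : Q.rep ∈ S) (hRS : R.rep ∈ S)
    (hSB : ∀ P ∈ B, P.rep ∈ S → P = Q ∨ P = R)
    (hbl : ∀ X : Submodule K V, Module.finrank K X = Module.finrank K S → ∃ P ∈ B, P.rep ∈ X)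
    (hQ : ∀ X : Submodule K V, Module.finrank K X = Module.finrank K S → Q.rep ∈ X →
      ∃ P ∈ B, P ≠ Q ∧ P.rep ∈ X)
    (hR : ∀ X : Submodule K V, Module.finrank K X = Module.finrank K S → R.rep ∈ X →
      ∃ P ∈ B, P ≠ R ∧ P.rep ∈ X)
    (t : V) (ht : t ∉ S) :
    2 * (Fintype.card K - 1) + 1 ≤
      (B.filter fun P => P.rep ∉ S ∧ P.rep ∈ S ⊔ Submodule.span K {t}).card := by
  obtain ⟨f, hfS, hft⟩ := exists_dual_zero_one S t ht
  obtain ⟨g1, hg1R, hg1Q⟩ := exists_dual_zero_one (Submodule.span K {R.rep}) Q.rep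
    (by rw [rep_mem_span_iff]; exact hQR)
  obtain ⟨g2, hg2Q, hg2R⟩ := exists_dual_zero_one (Submodule.span K {Q.rep}) R.rep
    (by rw [rep_mem_span_iff]; exact hQR.symm)
  replace hg1R := hg1R _ (Submodule.mem_span_singleton_self _)
  replace hg2Q := hg2Q _ (Submodule.mem_span_singleton_self _)
  set T := S ⊔ Submodule.span K {t} with hT
  have hlt : S < T := by
    refine lt_of_le_of_ne le_sup_left ?_
    intro h
    apply ht
    rw [h]
    exact Submodule.mem_sup_right (Submodule.mem_span_singleton_self t)
  have hTr := Submodule.finrank_lt_finrank_of_lt hlt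
  have hf0 : ∀ v ∈ T, v ∉ S → f v ≠ 0 := by
    intro v hv hvS h0
    obtain ⟨s, hs, w, hw, rfl⟩ := Submodule.mem_sup.1 hv
    obtain ⟨a, rfl⟩ := Submodule.mem_span_singleton.1 hw
    have ha : a = 0 := by simpa [hfS s hs, hft] using h0
    apply hvS
    simpa [ha] using hs
  apply jamison_plane _ (fun P => g1 P.rep / f P.rep) (fun P => g2 P.rep / f P.rep)
  intro a b c hab
  let l : V →ₗ[K] K := a • g1 + b • g2 + c • f
  have hlQ : l Q.rep = a := by simp [l, hg1Q, hg2Q, hfS _ hQS]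
  have hlR : l R.rep = b := by simp [l, hg1R, hg2R, hfS _ hRS]
  have hXr := finrank_inf_ker T l
  have key : ∃ P ∈ B, P.rep ∈ T ∧ l P.rep = 0 ∧ P.rep ∉ S := by
    by_cases ha : a = 0
    · have hQX : Q.rep ∈ T ⊓ LinearMap.ker l := ⟨hlt.le hQS, by simp [hlQ, ha]⟩
      obtain ⟨X, hLX, hX, hXf⟩ := exists_between_finrank (Submodule.span K {Q.rep})
        (T ⊓ LinearMap.ker l) (by simpa using hQX) (Module.finrank K S)
        (Submodule.finrank_mono (by simpa using hQS)) (by omega)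
      obtain ⟨P, hP, hPQ, hPX⟩ := hQ X hXf (by simpa using hLX)
      refine ⟨P, hP, (hX hPX).1, (hX hPX).2, fun hPS => ?_⟩
      rcases hSB P hP hPS with h | h
      · exact hPQ h
      · have h2 : l P.rep = 0 := (hX hPX).2
        rw [h, hlR] at h2
        simp_all
    · by_cases hb : b = 0
      · have hRX : R.rep ∈ T ⊓ LinearMap.ker l := ⟨hlt.le hRS, by simp [hlR, hb]⟩
        obtain ⟨X, hLX, hX, hXf⟩ := exists_between_finrank (Submodule.span K {R.rep})
          (T ⊓ LinearMap.ker l) (by simpa using hRX) (Module.finrank K S)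
          (Submodule.finrank_mono (by simpa using hRS)) (by omega)
        obtain ⟨P, hP, hPR, hPX⟩ := hR X hXf (by simpa using hLX)
        refine ⟨P, hP, (hX hPX).1, (hX hPX).2, fun hPS => ?_⟩
        rcases hSB P hP hPS with h | h
        · have h2 : l P.rep = 0 := (hX hPX).2
          rw [h, hlQ] at h2
          exact ha h2
        · exact hPR h
      · obtain ⟨X, -, hX, hXf⟩ := exists_between_finrank ⊥
          (T ⊓ LinearMap.ker l) bot_le (Module.finrank K S) (by simp) (by omega)
        obtain ⟨P, hP, hPX⟩ := hbl X hXf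
        have h2 : l P.rep = 0 := (hX hPX).2
        refine ⟨P, hP, (hX hPX).1, h2, fun hPS => ?_⟩
        rcases hSB P hP hPS with h | h
        · rw [h, hlQ] at h2
          exact ha h2
        · rw [h, hlR] at h2
          exact hb h2
  obtain ⟨P, hP, hPT, hl, hPS⟩ := key
  refine ⟨P, Finset.mem_filter.2 ⟨hP, hPS, hPT⟩, ?_⟩
  have hne := hf0 _ hPT hPS
  have hl' : a * g1 P.rep + b * g2 P.rep + c * f P.rep = 0 := by simpa [l] using hl
  field_simp
  linear_combination hl'

lemma two_pts {K V : Type*} [Field K] [Fintype K] [AddCommGroup V] [Module K V]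
    [FiniteDimensional K V] (S : Submodule K V) (k : ℕ) (hk : 1 ≤ k)
    (hrk : Module.finrank K V = Module.finrank K S + k)
    (B : Finset (Projectivization K V)) (Q R : Projectivization K V) (hQR : Q ≠ R)
    (hQB : Q ∈ B) (hRB : R ∈ B)
    (hQS : Q.rep ∈ S) (hRS : R.rep ∈ S)
    (hloc : ∀ t : V, t ∉ S → 2 * (Fintype.card K - 1) + 1 ≤
      (B.filter fun P => P.rep ∉ S ∧ P.rep ∈ S ⊔ Submodule.span K {t}).card) :
    2 * Fintype.card K ^ k ≤ B.card := by
  have : Finite (V ⧸ S) := Module.finite_of_finite K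
  have : Fintype (V ⧸ S) := Fintype.ofFinite _
  have hcW : Fintype.card (V ⧸ S) = Fintype.card K ^ k := by
    rw [Module.card_eq_pow_finrank (K := K) (V := V ⧸ S)]
    have := Submodule.finrank_quotient_add_finrank S
    congr 1
    omega
  set U := B.filter fun P => P.rep ∉ S with hU
  have hUB : U.card + 2 ≤ B.card := by
    have h1 : ({Q, R} : Finset _) ⊆ B.filter fun P => P.rep ∈ S := by
      intro P hP
      rcases Finset.mem_insert.1 hP with h | h
      · subst h; simp [hQB, hQS]
      · rw [Finset.mem_singleton] at h; subst h; simp [hRB, hRS]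
    have h2 := Finset.card_le_card h1
    rw [Finset.card_pair hQR] at h2
    have h3 : (B.filter fun P => P.rep ∈ S).card + U.card = B.card := by
      rw [hU, ← Finset.card_filter_add_card_filter_not (s := B) (fun P => P.rep ∈ S)]
    omega
  set E : Finset (V ⧸ S) := Finset.univ.erase 0 with hE
  have hEc : E.card = Fintype.card K ^ k - 1 := by
    rw [hE, Finset.card_erase_of_mem (Finset.mem_univ _), Finset.card_univ, hcW]
  have hlow : ∀ w ∈ E, 2 * (Fintype.card K - 1) + 1 ≤
      (U.filter fun P => S.mkQ P.rep ∈ Submodule.span K {w}).card := by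
    intro w hw
    obtain ⟨t, rfl⟩ := S.mkQ_surjective w
    have ht : t ∉ S := by
      intro h
      apply (Finset.mem_erase.1 hw).1
      simpa using h
    refine (hloc t ht).trans (Finset.card_le_card ?_)
    intro P hP
    rw [Finset.mem_filter] at hP
    obtain ⟨hPB, hPS, hPT⟩ := hP
    refine Finset.mem_filter.2 ⟨Finset.mem_filter.2 ⟨hPB, hPS⟩, ?_⟩
    obtain ⟨s, hs, w, hw, h⟩ := Submodule.mem_sup.1 hPT
    obtain ⟨a, rfl⟩ := Submodule.mem_span_singleton.1 hw
    rw [Submodule.mem_span_singleton]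
    refine ⟨a, ?_⟩
    rw [← h]
    simpa using hs
  have hupp : ∀ P ∈ U, (E.filter fun w => S.mkQ P.rep ∈ Submodule.span K {w}).card
      ≤ Fintype.card K - 1 := by
    intro P hP
    have hPS : P.rep ∉ S := (Finset.mem_filter.1 hP).2
    have hsub : (E.filter fun w => S.mkQ P.rep ∈ Submodule.span K {w}) ⊆
        (Finset.univ.erase (0 : K)).image (fun a => a • S.mkQ P.rep) := by
      intro w hw
      obtain ⟨hwE, hw⟩ := Finset.mem_filter.1 hw
      obtain ⟨a, ha⟩ := Submodule.mem_span_singleton.1 hw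
      have ha0 : a ≠ 0 := by
        rintro rfl
        apply hPS
        simpa using ha.symm
      refine Finset.mem_image.2 ⟨a⁻¹, by simp [ha0], ?_⟩
      rw [← ha, smul_smul, inv_mul_cancel₀ ha0, one_smul]
    refine (Finset.card_le_card hsub).trans (Finset.card_image_le.trans ?_)
    rw [Finset.card_erase_of_mem (Finset.mem_univ _), Finset.card_univ]
  have hsum : ∑ w ∈ E, (U.filter fun P => S.mkQ P.rep ∈ Submodule.span K {w}).card
      = ∑ P ∈ U, (E.filter fun w => S.mkQ P.rep ∈ Submodule.span K {w}).card := by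
    simp only [Finset.card_filter]
    exact Finset.sum_comm
  have h1 := Finset.card_nsmul_le_sum E _ _ hlow
  have h2 := Finset.sum_le_card_nsmul U _ _ hupp
  rw [hsum] at h1
  have h3 := h1.trans h2
  rw [hEc, smul_eq_mul, smul_eq_mul] at h3
  have hq : 1 < Fintype.card K := Fintype.one_lt_card
  have hqk : 1 < Fintype.card K ^ k := Nat.one_lt_pow (by omega) hq
  by_contra hcon
  push Not at hcon
  obtain ⟨r, hr⟩ : ∃ r, Fintype.card K = r + 2 := ⟨Fintype.card K - 2, by omega⟩
  obtain ⟨m, hm⟩ : ∃ m, Fintype.card K ^ k = m + 2 := ⟨Fintype.card K ^ k - 2, by omega⟩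
  rw [hm] at hcon h3
  rw [hr] at h3
  have e1 : r + 2 - 1 = r + 1 := by omega
  have e2 : m + 2 - 1 = m + 1 := by omega
  rw [e1, e2] at h3
  have h5 : U.card ≤ 2 * m + 1 := by omega
  have h6 := Nat.mul_le_mul_right (r + 1) h5
  nlinarith

/-- A point of a small blocking set that is on no tangent space lies with exactly one further
non-tangent point on some space: impossible. -/
lemma exists_tangent_or_good {K V : Type*} [Field K] [Fintype K] [AddCommGroup V] [Module K V]
    [FiniteDimensional K V] (m k : ℕ) (hk : 1 ≤ k) (hm : 1 ≤ m)
    (hrk : Module.finrank K V = m + k)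
    (B : Finset (Projectivization K V)) (hB : B.card < 2 * Fintype.card K ^ k)
    (hbl : ∀ X : Submodule K V, Module.finrank K X = m → ∃ P ∈ B, P.rep ∈ X)
    (R : Projectivization K V) (hRB : R ∈ B) :
    (∃ X : Submodule K V, Module.finrank K X = m ∧ R.rep ∈ X ∧ ∀ P ∈ B, P.rep ∈ X → P = R) ∨
    (∃ X : Submodule K V, ∃ Q ∈ B, Q ≠ R ∧ Module.finrank K X = m ∧ R.rep ∈ X ∧ Q.rep ∈ X ∧
      (∀ P ∈ B, P.rep ∈ X → P = Q ∨ P = R) ∧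
      ∃ Y : Submodule K V, Module.finrank K Y = m ∧ Q.rep ∈ Y ∧ ∀ P ∈ B, P.rep ∈ Y → P = Q) := by
  obtain ⟨f, hfR, hf⟩ := exists_map_few_zeros (K := K) k R.rep (B.erase R) (fun P => P.rep)
    (fun P hP => by rw [rep_mem_span_iff]; exact (Finset.mem_erase.1 hP).1)
    (lt_of_le_of_lt (Finset.card_le_card (Finset.erase_subset _ _)) hB)
  have hker : m ≤ Module.finrank K (LinearMap.ker f) := by
    have h1 := LinearMap.finrank_range_add_finrank_ker f
    have h2 := Submodule.finrank_le (LinearMap.range f)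
    simp only [Module.finrank_fin_fun] at h2
    omega
  obtain ⟨X, hRX, hXf, hXm⟩ := exists_between_finrank (Submodule.span K {R.rep})
    (LinearMap.ker f) (by simpa using hfR) m
    (by rw [finrank_span_singleton R.rep_nonzero]; exact hm) hker
  replace hRX : R.rep ∈ X := by simpa using hRX
  by_cases htan : ∃ X : Submodule K V, Module.finrank K X = m ∧ R.rep ∈ X ∧
      ∀ P ∈ B, P.rep ∈ X → P = R
  · exact Or.inl htan
  right
  have hR : ∀ X : Submodule K V, Module.finrank K X = m → R.rep ∈ X →
      ∃ P ∈ B, P ≠ R ∧ P.rep ∈ X := by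
    intro X h1 h2
    by_contra h3
    exact htan ⟨X, h1, h2, fun P hP hPX => by_contra fun h => h3 ⟨P, hP, h, hPX⟩⟩
  obtain ⟨Q, hQB, hQR, hQX⟩ := hR X hXm hRX
  have hXB : ∀ P ∈ B, P.rep ∈ X → P = Q ∨ P = R := by
    intro P hP hPX
    by_cases hPR : P = R
    · exact Or.inr hPR
    · left
      exact Finset.card_le_one.1 hf P
        (Finset.mem_filter.2 ⟨Finset.mem_erase.2 ⟨hPR, hP⟩, LinearMap.mem_ker.1 (hXf hPX)⟩) Q
        (Finset.mem_filter.2 ⟨Finset.mem_erase.2 ⟨hQR, hQB⟩, LinearMap.mem_ker.1 (hXf hQX)⟩)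
  refine ⟨X, Q, hQB, hQR, hXm, hRX, hQX, hXB, ?_⟩
  by_contra htanQ
  have hQ : ∀ X : Submodule K V, Module.finrank K X = m → Q.rep ∈ X →
      ∃ P ∈ B, P ≠ Q ∧ P.rep ∈ X := by
    intro X h1 h2
    by_contra h3
    exact htanQ ⟨X, h1, h2, fun P hP hPX => by_contra fun h => h3 ⟨P, hP, h, hPX⟩⟩
  have := two_pts X k hk (by omega) B Q R hQR hQB hRB hQX hRX
    (fun t ht => two_pts_local X B Q R hQR hQX hRX hXB (by rwa [hXm]) (by rwa [hXm])
      (by rwa [hXm]) t ht)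
  omega

lemma submodule_le_iff_rep {K V : Type*} [Field K] [AddCommGroup V] [Module K V]
    (P : Projectivization K V) (S : Submodule K V) : P.submodule ≤ S ↔ P.rep ∈ S := by
  rw [P.submodule_eq]
  simp

/-- The number of points of a nonzero subspace is `1` mod `p`. -/
lemma card_points (p h n : ℕ) [Fact p.Prime] (hh : 0 < h)
    (X : Submodule (GaloisField p h) (Fin (n+1) → GaloisField p h)) (hX : X ≠ ⊥) :
    ((Finset.univ.filter fun P : PGPoint p h n => P.submodule ≤ X).card : ZMod p) = 1 := by
  have hc : (Finset.univ.filter fun P : PGPoint p h n => P.submodule ≤ X).card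
      = Nat.card (Projectivization (GaloisField p h) X) := by
    rw [← Fintype.card_subtype, ← Nat.card_eq_fintype_card]
    symm
    refine Nat.card_congr (Equiv.ofBijective (fun P => ⟨Projectivization.map X.subtype
      X.injective_subtype P, ?_⟩) ⟨?_, ?_⟩)
    · induction P using Projectivization.ind with
      | h v hv =>
        rw [Projectivization.map_mk, Projectivization.submodule_mk]
        simp
    · intro P P' h
      exact Projectivization.map_injective X.subtype X.injective_subtype (congrArg Subtype.val h)
    · rintro ⟨P, hP⟩
      have hP' := (submodule_le_iff_rep P X).1 hP
      refine ⟨Projectivization.mk _ ⟨P.rep, hP'⟩ ?_, ?_⟩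
      · intro h
        exact P.rep_nonzero (congrArg Subtype.val h)
      · apply Subtype.ext
        simp [Projectivization.map_mk, Projectivization.mk_rep]
  rw [hc]
  have h1 := Projectivization.card' (GaloisField p h) X
  rw [Module.natCard_eq_pow_finrank (K := GaloisField p h) (V := X),
    GaloisField.card p h hh.ne'] at h1
  have hr : 0 < Module.finrank (GaloisField p h) X := by
    rw [Nat.pos_iff_ne_zero]
    intro h
    exact hX (Submodule.finrank_eq_zero.1 h)
  have h2 := congrArg (Nat.cast : ℕ → ZMod p) h1
  have hp : 1 ≤ p ^ h := Nat.one_le_pow _ _ (Fact.out : p.Prime).pos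
  push_cast [Nat.cast_sub hp] at h2
  simp only [CharP.cast_eq_zero, zero_pow hh.ne', zero_pow hr.ne'] at h2
  linear_combination h2

lemma ip_const (p h n k : ℕ) [Fact p.Prime] (hh : 0 < h) (hkn : k ≤ n)
    (c : PGPoint p h n → ZMod p) (hc : c ∈ PGCode p h n k)
    (S S' : Submodule (GaloisField p h) (Fin (n+1) → GaloisField p h))
    (hS : Module.finrank (GaloisField p h) S = n - k + 1)
    (hS' : Module.finrank (GaloisField p h) S' = n - k + 1) :
    ip c (incVec p h n S) = ip c (incVec p h n S') := by
  have key : ∀ W S : Submodule (GaloisField p h) (Fin (n+1) → GaloisField p h),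
      Module.finrank (GaloisField p h) W = k + 1 →
      Module.finrank (GaloisField p h) S = n - k + 1 →
      ip (incVec p h n W) (incVec p h n S) = 1 := by
    intro W S hW hS
    have hne : W ⊓ S ≠ ⊥ := by
      intro h0
      have h1 := Submodule.finrank_sup_add_finrank_inf_eq W S
      have h2 := Submodule.finrank_le (W ⊔ S)
      rw [h0, finrank_bot] at h1
      rw [Module.finrank_fin_fun] at h2
      omega
    rw [← card_points p h n hh _ hne, Finset.card_filter]
    push_cast
    unfold ip incVec
    refine Finset.sum_congr rfl fun P _ => ?_
    by_cases h1 : P.submodule ≤ W <;> by_cases h2 : P.submodule ≤ S <;> simp [h1, h2]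
  unfold PGCode at hc
  induction hc using Submodule.span_induction with
  | mem x hx =>
    obtain ⟨W, hW, rfl⟩ := hx
    rw [key W S hW hS, key W S' hW hS']
  | zero => simp [ip]
  | add x y _ _ hx hy =>
    simp only [ip, Pi.add_apply, add_mul, Finset.sum_add_distrib] at *
    rw [hx, hy]
  | smul a x _ hx =>
    simp only [ip, Pi.smul_apply, smul_eq_mul, mul_assoc, ← Finset.mul_sum] at *
    rw [hx]

/-- a codeword `c ∈ C_k(n,q)` of weight `< 2q^k` with `(c,S) ≠ 0` for some
`(n-k)`-space `S` has as support a minimal `k`-blocking set, takes a single nonzero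
value, and its support meets every `(n-k)`-space in `1 mod p` points. -/
theorem stmt7 (p h n k : ℕ) [Fact p.Prime] (hh : 0 < h) (hk1 : 1 ≤ k) (hkn : k ≤ n)
    (c : PGPoint p h n → ZMod p) (hc : c ∈ PGCode p h n k)
    (hwt : wt c < 2 * (p ^ h) ^ k)
    (S₀ : Submodule (GaloisField p h) (Fin (n+1) → GaloisField p h))
    (hS₀ : Module.finrank (GaloisField p h) S₀ = n - k + 1)
    (hne : ip c (incVec p h n S₀) ≠ 0) :
    (IsKBlockingSet p h n k { P | c P ≠ 0 } ∧
      ∀ B' ⊂ { P | c P ≠ 0 }, ¬ IsKBlockingSet p h n k B') ∧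
    (∃ a : ZMod p, a ≠ 0 ∧ ∀ P, c P = 0 ∨ c P = a) ∧
    (∀ S : Submodule (GaloisField p h) (Fin (n+1) → GaloisField p h),
      Module.finrank (GaloisField p h) S = n - k + 1 →
        (Finset.univ.filter fun P : PGPoint p h n => c P ≠ 0 ∧ P.submodule ≤ S).card % p
          = 1 % p) := by
  have ipS : ∀ S, ip c (incVec p h n S) = ∑ P with P.submodule ≤ S, c P := by
    intro S
    rw [Finset.sum_filter]
    refine Finset.sum_congr rfl fun P _ => ?_
    by_cases h1 : P.submodule ≤ S <;> simp [incVec, h1]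
  obtain ⟨a, ha⟩ : ∃ a, a = ip c (incVec p h n S₀) := ⟨_, rfl⟩
  have ha0 : a ≠ 0 := ha ▸ hne
  have hcon : ∀ S : Submodule (GaloisField p h) (Fin (n+1) → GaloisField p h),
      Module.finrank (GaloisField p h) S = n - k + 1 →
      ∑ P with P.submodule ≤ S, c P = a := by
    intro S hS
    rw [← ipS, ha]
    exact ip_const p h n k hh hkn c hc S S₀ hS hS₀
  have hbl : IsKBlockingSet p h n k { P | c P ≠ 0 } := by
    intro S hS
    by_contra hno
    apply ha0
    rw [← hcon S hS]
    refine Finset.sum_eq_zero fun P hP => ?_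
    by_contra hP0
    exact hno ⟨P, hP0, (Finset.mem_filter.1 hP).2⟩
  have : Fintype (GaloisField p h) := Fintype.ofFinite _
  have hcard : Fintype.card (GaloisField p h) = p ^ h := by
    rw [← Nat.card_eq_fintype_card, GaloisField.card p h hh.ne']
  set B : Finset (PGPoint p h n) := Finset.univ.filter fun P => c P ≠ 0 with hB
  have hmemB : ∀ P, P ∈ B ↔ c P ≠ 0 := fun P => by simp [hB]
  have htanval : ∀ (R : PGPoint p h n)
      (X : Submodule (GaloisField p h) (Fin (n+1) → GaloisField p h)),
      Module.finrank (GaloisField p h) X = n - k + 1 → R.rep ∈ X →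
      (∀ P ∈ B, P.rep ∈ X → P = R) → c R = a := by
    intro R X hX hRX hX'
    rw [← hcon X hX, Finset.sum_eq_single R]
    · intro P hP hPR
      by_contra hP0
      exact hPR (hX' P ((hmemB P).2 hP0)
        ((submodule_le_iff_rep P X).1 (Finset.mem_filter.1 hP).2))
    · intro hR
      exact (hR (Finset.mem_filter.2 ⟨Finset.mem_univ _, (submodule_le_iff_rep R X).2 hRX⟩)).elim
  have htan : ∀ R : PGPoint p h n, c R ≠ 0 →
      ∃ X : Submodule (GaloisField p h) (Fin (n+1) → GaloisField p h),
        Module.finrank (GaloisField p h) X = n - k + 1 ∧ R.rep ∈ X ∧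
        ∀ P ∈ B, P.rep ∈ X → P = R := by
    intro R hR
    rcases exists_tangent_or_good (K := GaloisField p h) (V := Fin (n+1) → GaloisField p h)
      (n - k + 1) k hk1 (by omega) (by rw [Module.finrank_fin_fun]; omega) B
      (by rw [hcard]; exact hwt)
      (fun X hX => by
        obtain ⟨P, hP, hPX⟩ := hbl X hX
        exact ⟨P, (hmemB P).2 hP, (submodule_le_iff_rep P X).1 hPX⟩)
      R ((hmemB R).2 hR) with h1 | ⟨X, Q, hQB, hQR, hX, hRX, hQX, hXB, Y, hY, hQY, hYB⟩
    · exact h1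
    · exfalso
      have hQa := htanval Q Y hY hQY hYB
      have hs := hcon X hX
      have hs2 : ∑ P with P.submodule ≤ X, c P = ∑ P ∈ {Q, R}, c P := by
        symm
        apply Finset.sum_subset
        · intro P hP
          rw [Finset.mem_insert, Finset.mem_singleton] at hP
          refine Finset.mem_filter.2 ⟨Finset.mem_univ _, (submodule_le_iff_rep P X).2 ?_⟩
          rcases hP with rfl | rfl
          · exact hQX
          · exact hRX
        · intro P hP hP2
          by_contra hP0
          apply hP2
          rw [Finset.mem_insert, Finset.mem_singleton]
          exact hXB P ((hmemB P).2 hP0)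
            ((submodule_le_iff_rep P X).1 (Finset.mem_filter.1 hP).2)
      rw [hs2, Finset.sum_pair hQR, hQa] at hs
      exact hR (by linear_combination hs)
  have hval : ∀ P, c P = 0 ∨ c P = a := by
    intro P
    by_cases hP : c P = 0
    · exact Or.inl hP
    · obtain ⟨X, hX, hPX, hXB⟩ := htan P hP
      exact Or.inr (htanval P X hX hPX hXB)
  refine ⟨⟨hbl, ?_⟩, ⟨a, ha0, hval⟩, ?_⟩
  · intro B' hB' hbl'
    obtain ⟨hsub, hnsub⟩ := hB'
    obtain ⟨R, hR, hRB'⟩ := Set.not_subset.1 hnsub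
    obtain ⟨X, hX, hRX, hXB⟩ := htan R hR
    obtain ⟨P, hP, hPX⟩ := hbl' X hX
    have := hXB P ((hmemB P).2 (hsub hP)) ((submodule_le_iff_rep P X).1 hPX)
    exact hRB' (this ▸ hP)
  · intro S hS
    have h1 := hcon S hS
    have h2 : ∑ P with P.submodule ≤ S, c P
        = ((Finset.univ.filter fun P : PGPoint p h n => c P ≠ 0 ∧ P.submodule ≤ S).card : ZMod p)
          * a := by
      rw [← nsmul_eq_mul, ← Finset.sum_const, Finset.sum_filter, Finset.sum_filter]
      refine Finset.sum_congr rfl fun P _ => ?_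
      by_cases hPS : P.submodule ≤ S <;> rcases hval P with hP | hP <;> simp [hPS, hP, ha0]
    rw [h2] at h1
    have h3 : ((Finset.univ.filter fun P : PGPoint p h n =>
        c P ≠ 0 ∧ P.submodule ≤ S).card : ZMod p) = ((1 : ℕ) : ZMod p) := by
      rw [Nat.cast_one]
      exact mul_right_cancel₀ ha0 (by rw [h1, one_mul])
    exact (ZMod.natCast_eq_natCast_iff _ _ _).1 h3
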